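/- The number of equivalence relations ⋈ on {1,…,6} such that the polydiagonal subspace Δ_⋈ ⊆ ℝ⁶ is A-invariant is exactly 31 (namely: the equality relation, the total relation corresponding to full synchrony, and the 29 nontrivial balanced relations of the network G₆, which fall into eight pattern types with 3, 3, 6, 3, 3, 4, 6 and 1 members). -/

import Mathlib

open Matrix

/-- The adjacency matrix of the ring network G₆ of six cells with nearest and
next-nearest neighbour coupling: `A i j = 1` iff `i - j ≡ ±1, ±2 (mod 6)`. -/
def A6 : Matrix (Fin 6) (Fin 6) ℝ :=
  Matrix.of fun i j =>
    if i - j = 1 ∨ i - j = 2 ∨ j - i = 1 ∨ j - i = 2 then 1 else 0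

/-- Codes for candidate "least representative" maps. -/
abbrev Code6 := Fin 2 × Fin 3 × Fin 4 × Fin 5 × Fin 6

/-- The map `Fin 6 → Fin 6` with `f i ≤ i` attached to a code. -/
def dec6 (p : Code6) : Fin 6 → Fin 6 :=
  ![0, p.1.castLE (by omega), p.2.1.castLE (by omega), p.2.2.1.castLE (by omega),
    p.2.2.2.1.castLE (by omega), p.2.2.2.2]

/-- Idempotent with kernel stable under the antipodal map. -/
def good6 (p : Code6) : Prop :=
  (∀ i, dec6 p (dec6 p i) = dec6 p i) ∧
    ∀ i j, dec6 p i = dec6 p j → dec6 p (i + 3) = dec6 p (j + 3)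

instance : DecidablePred good6 := fun p => by unfold good6; infer_instance

lemma card_good6 : (Finset.univ.filter good6).card = 31 := by decide +kernel

lemma dec6_le (p : Code6) (i : Fin 6) : dec6 p i ≤ i := by
  obtain ⟨a, b, c, d, e⟩ := p
  fin_cases i <;> simp [dec6, Fin.le_def] <;> omega

lemma dec6_inj {p q : Code6} (h : dec6 p = dec6 q) : p = q := by
  obtain ⟨a, b, c, d, e⟩ := p
  obtain ⟨a', b', c', d', e'⟩ := q
  have h1 := congrFun h 1
  have h2 := congrFun h 2
  have h3 := congrFun h 3
  have h4 := congrFun h 4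
  have h5 := congrFun h 5
  simp [dec6, Fin.ext_iff] at h1 h2 h3 h4 h5
  simp [Prod.ext_iff, Fin.ext_iff, *]

lemma dec6_surj (f : Fin 6 → Fin 6) (hf : ∀ i, f i ≤ i) : ∃ p, dec6 p = f := by
  have h0 := hf 0
  have h1 := hf 1
  have h2 := hf 2
  have h3 := hf 3
  have h4 := hf 4
  simp only [Fin.le_def] at h0 h1 h2 h3 h4
  refine ⟨(⟨f 1, Nat.lt_succ_of_le h1⟩, ⟨f 2, Nat.lt_succ_of_le h2⟩,
    ⟨f 3, Nat.lt_succ_of_le h3⟩, ⟨f 4, Nat.lt_succ_of_le h4⟩, f 5), ?_⟩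
  funext i
  fin_cases i <;> simp [dec6, Fin.ext_iff]
  simpa [Fin.ext_iff, eq_comm] using h0

lemma A6_mulVec (x : Fin 6 → ℝ) (i : Fin 6) :
    A6.mulVec x i = (∑ k, x k) - x i - x (i + 3) := by
  fin_cases i <;>
    simp +decide [A6, Matrix.mulVec, dotProduct, Fin.sum_univ_six] <;> ring

lemma inv_iff (r : Setoid (Fin 6)) :
    (∀ x : Fin 6 → ℝ, (∀ i j, r.r i j → x i = x j) →
        ∀ i j, r.r i j → A6.mulVec x i = A6.mulVec x j) ↔
      ∀ i j, r i j → r (i + 3) (j + 3) := by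
  classical
  constructor
  · intro h i j hij
    have := h (fun k => if r (i + 3) k then 1 else 0) (by
      intro a b hab
      have : r (i + 3) a ↔ r (i + 3) b :=
        ⟨fun h => r.trans' h hab, fun h => r.trans' h (r.symm' hab)⟩
      simp [this]) i j hij
    have e : r (i + 3) i ↔ r (i + 3) j :=
      ⟨fun h => r.trans' h hij, fun h => r.trans' h (r.symm' hij)⟩
    rw [A6_mulVec, A6_mulVec] at this
    simp only [e, r.refl' (i + 3), if_true] at this
    by_contra hn
    simp [hn] at this
  · intro h x hx i j hij
    rw [A6_mulVec, A6_mulVec, hx i j hij, hx _ _ (h i j hij)]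

/-- There are exactly 31 equivalence relations on {1,…,6} whose polydiagonal
subspace of ℝ⁶ is invariant under the adjacency matrix of G₆ (Table 1). -/
theorem stmt_12 :
    Set.ncard {r : Setoid (Fin 6) |
      ∀ x : Fin 6 → ℝ, (∀ i j, r.r i j → x i = x j) →
        ∀ i j, r.r i j → A6.mulVec x i = A6.mulVec x j} = 31 := by
  classical
  have key : {r : Setoid (Fin 6) |
      ∀ x : Fin 6 → ℝ, (∀ i j, r.r i j → x i = x j) →
        ∀ i j, r.r i j → A6.mulVec x i = A6.mulVec x j} =
      (fun p => Setoid.ker (dec6 p)) '' (Finset.univ.filter good6 : Finset Code6) := by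
    ext r
    rw [Set.mem_setOf_eq, inv_iff]
    constructor
    · intro h
      have hne : ∀ i, (Finset.univ.filter (fun k => r i k)).Nonempty :=
        fun i => ⟨i, by simpa using r.refl' i⟩
      let f : Fin 6 → Fin 6 := fun i => (Finset.univ.filter (fun k => r i k)).min' (hne i)
      have hfr : ∀ i, r i (f i) := fun i => by
        simpa using Finset.min'_mem _ (hne i)
      have hfle : ∀ i k, r i k → f i ≤ k := fun i k hk =>
        Finset.min'_le _ _ (by simpa using hk)
      have hfe : ∀ i j, f i = f j ↔ r i j := fun i j => by
        constructor
        · intro e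
          exact r.trans' (hfr i) (e ▸ r.symm' (hfr j))
        · intro e
          exact le_antisymm (hfle _ _ (r.trans' e (hfr j)))
            (hfle _ _ (r.trans' (r.symm' e) (hfr i)))
      obtain ⟨p, hp⟩ := dec6_surj f (fun i => hfle i i (r.refl' i))
      refine ⟨p, ?_, ?_⟩
      · simp only [Finset.coe_filter, Finset.mem_univ, true_and, Set.mem_setOf_eq, good6, hp]
        refine ⟨fun i => (hfe _ _).2 (r.symm' (hfr i)), fun i j e => ?_⟩
        exact (hfe _ _).2 (h i j ((hfe i j).1 e))
      · ext i j
        change dec6 p i = dec6 p j ↔ r i j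
        rw [hp]
        exact hfe i j
    · rintro ⟨p, hp, rfl⟩
      simp only [Finset.coe_filter, Finset.mem_univ, true_and, Set.mem_setOf_eq] at hp
      exact hp.2
  rw [key, Set.ncard_image_of_injOn, Set.ncard_coe_finset, card_good6]
  intro p hp q hq e
  simp only [Finset.coe_filter, Finset.mem_univ, true_and, Set.mem_setOf_eq] at hp hq
  have e' : ∀ i j, dec6 p i = dec6 p j ↔ dec6 q i = dec6 q j := fun i j =>
    Setoid.ext_iff.1 e i j
  apply dec6_inj
  funext i
  apply le_antisymm
  · rw [(e' i (dec6 q i)).2 (hq.1 i).symm]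
    exact dec6_le _ _
  · rw [(e' i (dec6 p i)).1 (hp.1 i).symm]
    exact dec6_le _ _
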